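/- Let n ≥ 0 and m be integers, let W = p₁δⁿq₁r₁s₁δᵐt₁, let k = n/2 if n is even and k = (n−1)/2 if n is odd, and set W₂ = p₂q₂δᵏr₂δᵏs₂δᵐt₂ and W₃ = p₃δq₃δᵏr₃δᵏs₃δᵐt₃. Then: (i) every reduced computation of S₁ starting at W is semiproper; (ii) every word occurring in any computation starting at W has the form pᵢδ^{ℓ₁}qᵢδ^{ℓ₂}rᵢδ^{ℓ₂}sᵢδᵐtᵢ with ℓ₁ + 2ℓ₂ = n and i ∈ {1,2,3}; (iii) CS₁(W, q₁r₁) consists of the single trivial computation; (iv) S₁(W, p₂) holds if and only if n is even, in which case CS₁(W, p₂) consists of exactly one computation, whose history is rule (1) applied n/2 times followed by rule (2) and whose last word is W₂; (v) S₁(W, p₃) holds if and only if n is odd, in which case CS₁(W, p₃) consists of exactly one computation, whose history is rule (1) applied (n−1)/2 times followed by rule (3) and whose last word is W₃. -/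

import Mathlib

/-! ### S-machines -/

/-- A group word over tape letters `T` and state letters `S`. -/
abbrev GWord (T S : Type) := List ((T ⊕ S) × Bool)

/-- An `S`-rule `[U₁ → V₁, …, U_m → V_m]`, listed in left-to-right order. -/
structure SRule (T S : Type) where
  subs : List (GWord T S × GWord T S)
deriving DecidableEq

/-- The formal inverse of a group word. -/
def invWord {T S : Type} (w : GWord T S) : GWord T S := (w.map fun p => (p.1, !p.2)).reverse

/-- The inverse of an `S`-rule: if `τ = [Uᵢ → xᵢ Vᵢ' yᵢ]` where `Vᵢ'` starts and ends with
state letters, then `τ⁻¹ = [Vᵢ' → xᵢ⁻¹ Uᵢ yᵢ⁻¹]`. -/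
def ruleInv {T S : Type} (r : SRule T S) : SRule T S :=
  ⟨r.subs.map fun UV =>
    let x := UV.2.takeWhile fun p => p.1.isLeft
    let y := (UV.2.reverse.takeWhile fun p => p.1.isLeft).reverse
    ((UV.2.drop x.length).take (UV.2.length - x.length - y.length),
      invWord x ++ UV.1 ++ invWord y)⟩

/-- The hardware of an `S`-machine: `n` sectors of tape letters and `n + 1` components
of state letters. -/
structure SHardware (T S : Type) where
  n : ℕ
  Y : Fin n → Set T
  Q : Fin (n + 1) → Set S

/-- Lifting a word over tape letters to a group word. -/
def liftT {T S : Type} (u : List (T × Bool)) : GWord T S := u.map fun p => (Sum.inl p.1, p.2)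

/-- A word is freely reduced (irreducible): no adjacent pair `x x⁻¹` or `x⁻¹ x`. -/
def FreeReduced {β : Type} (u : List (β × Bool)) : Prop :=
  u.Chain' fun p q => ¬(p.1 = q.1 ∧ q.2 = !p.2)

/-- The admissible word `q₀ u₀ q₁ u₁ ⋯ u_{n-1} q_n`. -/
def SHardware.assemble {T S : Type} (H : SHardware T S) (q : Fin (H.n + 1) → S)
    (u : Fin H.n → List (T × Bool)) : GWord T S :=
  (((List.finRange H.n).map fun i => ((Sum.inr (q i.castSucc), true) :: liftT (u i))).flatten)
    ++ [(Sum.inr (q (Fin.last H.n)), true)]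

/-- A word is admissible for the hardware `H` if it lies in
`Q₁ F(Y₁) Q₂ F(Y₂) ⋯ F(Y_n) Q_{n+1}`. -/
def SHardware.Admissible {T S : Type} (H : SHardware T S) (w : GWord T S) : Prop :=
  ∃ (q : Fin (H.n + 1) → S) (u : Fin H.n → List (T × Bool)),
    (∀ i, q i ∈ H.Q i) ∧ (∀ i, (∀ p ∈ u i, p.1 ∈ H.Y i) ∧ FreeReduced (u i)) ∧
    w = H.assemble q u

/-- `Splice subs w z`: `w = x₀ U₁ x₁ U₂ ⋯ U_m x_m` and `z = x₀ V₁ x₁ V₂ ⋯ V_m x_m`,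
where `subs = [(U₁,V₁),…,(U_m,V_m)]` (simultaneous replacement, in order). -/
def Splice {T S : Type} : List (GWord T S × GWord T S) → GWord T S → GWord T S → Prop
  | [], w, z => w = z
  | UV :: rest, w, z =>
      ∃ x w₁ z₁, w = x ++ UV.1 ++ w₁ ∧ z = x ++ UV.2 ++ z₁ ∧ Splice rest w₁ z₁

/-- Applying an `S`-rule: replace the `Uᵢ` simultaneously by the `Vᵢ` and freely reduce. -/
def ApplyRule {T S : Type} (r : SRule T S) (w w' : GWord T S) : Prop :=
  ∃ z, Splice r.subs w z ∧ FreeGroup.Red z w' ∧ FreeReduced w'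

/-- An `S`-machine: a hardware together with a (finite, symmetric) list of rules. -/
structure SMachine (T S : Type) where
  H : SHardware T S
  rules : List (SRule T S)
  symm : ∀ r ∈ rules, ruleInv r ∈ rules

/-- `ws` is a computation of the `S`-machine `M` with history `h`: a nonempty sequence of
admissible words, each obtained from the previous one by applying the corresponding rule
of the history. -/
def IsComputation {T S : Type} (M : SMachine T S) (ws : List (GWord T S))
    (h : List (SRule T S)) : Prop :=
  ws ≠ [] ∧ h.length + 1 = ws.length ∧ (∀ w ∈ ws, M.H.Admissible w) ∧
  ∀ i, i < h.length →
    h.getD i ⟨[]⟩ ∈ M.rules ∧ ApplyRule (h.getD i ⟨[]⟩) (ws.getD i []) (ws.getD (i + 1) [])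

/-- A history is reduced: two mutually inverse rules are never applied next to
each other. -/
def ReducedHist {T S : Type} (h : List (SRule T S)) : Prop :=
  ∀ i, i + 1 < h.length → h.getD (i + 1) ⟨[]⟩ ≠ ruleInv (h.getD i ⟨[]⟩)

/-- The first word of a computation. -/
def firstW {T S : Type} (ws : List (GWord T S)) : GWord T S := ws.headI

/-- The last word `τC` of a computation. -/
def lastW {T S : Type} (ws : List (GWord T S)) : GWord T S := ws.getLastD []

/-- The computation `(ws, h)` connects `W` and `W'`. -/
def Connects {T S : Type} (M : SMachine T S) (ws : List (GWord T S)) (h : List (SRule T S))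
    (W W' : GWord T S) : Prop :=
  IsComputation M ws h ∧ firstW ws = W ∧ lastW ws = W'

/-- The number of occurrences of the negative letter `a⁻¹` in a word. -/
def negCount {T S : Type} [DecidableEq T] (a : T) (w : GWord T S) : ℕ :=
  w.countP fun p => (match p.1 with | Sum.inl t => decide (t = a) | Sum.inr _ => false) && !p.2

/-- A computation is semiproper: negative letters inserted during the computation
(in excess of those present in the first word) never disappear at a later stage. -/
def Semiproper {T S : Type} [DecidableEq T] (ws : List (GWord T S)) : Prop :=
  ∀ a : T, ∀ i j : ℕ, i ≤ j → j < ws.length →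
    negCount a (ws.getD i []) - negCount a (ws.getD 0 []) ≤ negCount a (ws.getD j [])

/-- A word is positive: it contains no negative letters. -/
def PositiveW {T S : Type} (w : GWord T S) : Prop := ∀ p ∈ w, p.2 = true

/-- Membership in `CS(W, v₁, …, v_k)`: `(ws, h)` is a reduced computation starting at `W`
whose last word contains each of the words in `vs` as a subword. -/
def InCS {T S : Type} (M : SMachine T S) (ws : List (GWord T S)) (h : List (SRule T S))
    (W : GWord T S) (vs : List (GWord T S)) : Prop :=
  IsComputation M ws h ∧ ReducedHist h ∧ firstW ws = W ∧ ∀ v ∈ vs, v <:+: lastW ws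

/-- The area of a computation: the sum of the lengths of its words. -/
def SArea {T S : Type} (ws : List (GWord T S)) : ℕ := (ws.map List.length).sum

/-! ### The `S`-machine `S₁` -/

/-- The state letters of `S₁`. -/
inductive St : Type
  | p1 | p2 | p3 | q1 | q2 | q3 | r1 | r2 | r3 | s1 | s2 | s3 | t1 | t2 | t3
deriving DecidableEq

open St

/-- A (positive) state letter, as a letter of a group word. -/
def st (x : St) : (Unit ⊕ St) × Bool := (Sum.inr x, true)

/-- The tape letter `δ` or its inverse. -/
def dl (b : Bool) : (Unit ⊕ St) × Bool := (Sum.inl (), b)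

/-- The word `δ^k` (for an integer `k`). -/
def dpow (k : ℤ) : GWord Unit St :=
  if 0 ≤ k then List.replicate k.toNat (dl true) else List.replicate (-k).toNat (dl false)

/-- The admissible word `p δ^a q δ^b r δ^c s δ^d t`. -/
def wform (p q r s t : St) (a b c d : ℤ) : GWord Unit St :=
  [st p] ++ dpow a ++ [st q] ++ dpow b ++ [st r] ++ dpow c ++ [st s] ++ dpow d ++ [st t]

/-- The hardware of `S₁` (and of `S₃`): four sectors with tape letter `δ`, five
components of state letters. -/
def H1 : SHardware Unit St where
  n := 4
  Y := fun _ => Set.univ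
  Q := ![{p1, p2, p3}, {q1, q2, q3}, {r1, r2, r3}, {s1, s2, s3}, {t1, t2, t3}]

/-- Rule (1): `[q₁ → δ⁻² q₁ δ², r₁ → δ⁻¹ r₁ δ]`. -/
def rule1 : SRule Unit St :=
  ⟨[([st q1], [dl false, dl false, st q1, dl true, dl true]),
    ([st r1], [dl false, st r1, dl true])]⟩

/-- Rule (2): `[p₁q₁ → p₂q₂, r₁ → r₂, s₁ → s₂, t₁ → t₂]`. -/
def rule2 : SRule Unit St :=
  ⟨[([st p1, st q1], [st p2, st q2]), ([st r1], [st r2]),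
    ([st s1], [st s2]), ([st t1], [st t2])]⟩

/-- Rule (3): `[p₁δq₁ → p₃δq₃, r₁ → r₃, s₁ → s₃, t₁ → t₃]`. -/
def rule3 : SRule Unit St :=
  ⟨[([st p1, dl true, st q1], [st p3, dl true, st q3]), ([st r1], [st r3]),
    ([st s1], [st s3]), ([st t1], [st t3])]⟩

/-- The `S`-machine `S₁`. -/
def M1 : SMachine Unit St where
  H := H1
  rules := [rule1, rule2, rule3, ruleInv rule1, ruleInv rule2, ruleInv rule3]
  symm := by decide

/-- `W = p₁ δⁿ q₁ r₁ s₁ δᵐ t₁`. -/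
def Wst (n : ℕ) (m : ℤ) : GWord Unit St := wform p1 q1 r1 s1 t1 n 0 0 m

/-- `W₂ = p₂ q₂ δᵏ r₂ δᵏ s₂ δᵐ t₂` where `k = n / 2`. -/
def W2 (n : ℕ) (m : ℤ) : GWord Unit St := wform p2 q2 r2 s2 t2 0 (n / 2) (n / 2) m

/-- `W₃ = p₃ δ q₃ δᵏ r₃ δᵏ s₃ δᵐ t₃` where `k = (n - 1) / 2`. -/
def W3 (n : ℕ) (m : ℤ) : GWord Unit St :=
  wform p3 q3 r3 s3 t3 1 (((n : ℤ) - 1) / 2) (((n : ℤ) - 1) / 2) m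

/-- the `p`-letters -/ def pv : Fin 3 → St := ![p1, p2, p3]
/-- the `q`-letters -/ def qv : Fin 3 → St := ![q1, q2, q3]
/-- the `r`-letters -/ def rv : Fin 3 → St := ![r1, r2, r3]
/-- the `s`-letters -/ def sv : Fin 3 → St := ![s1, s2, s3]
/-- the `t`-letters -/ def tv : Fin 3 → St := ![t1, t2, t3]

/-! ### Freely reduced words -/

theorem freeReduced_iff_isChain {β : Type} (u : List (β × Bool)) :
    FreeReduced u ↔ u.IsChain fun p q => ¬(p.1 = q.1 ∧ q.2 = !p.2) := Iff.rfl

theorem freeReduced_iff_isReduced {β : Type} (u : List (β × Bool)) :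
    FreeReduced u ↔ FreeGroup.IsReduced u := by
  have key : (fun p q : β × Bool => ¬(p.1 = q.1 ∧ q.2 = !p.2)) =
      fun p q => p.1 = q.1 → p.2 = q.2 := by
    funext p q
    rcases p with ⟨a, _ | _⟩ <;> rcases q with ⟨b, _ | _⟩ <;> simp
  rw [freeReduced_iff_isChain, key, FreeGroup.IsReduced]

theorem red_and_freeReduced_iff {β : Type} {z w v : List (β × Bool)}
    (hzw : FreeGroup.mk z = FreeGroup.mk w) (hw : FreeReduced w) :
    (FreeGroup.Red z v ∧ FreeReduced v) ↔ v = w := by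
  classical
  rw [freeReduced_iff_isReduced] at *
  have hz : FreeGroup.reduce z = w := by
    rw [← hw.reduce_eq]; exact FreeGroup.reduce.sound hzw
  constructor
  · rintro ⟨h, hv⟩
    rw [← hv.reduce_eq, ← FreeGroup.reduce.eq_of_red h, hz]
  · rintro rfl
    exact ⟨hz ▸ FreeGroup.reduce.red, hw⟩

/-! ### Powers of `δ` and admissible words -/

@[simp] theorem st_inj {x y : St} : st x = st y ↔ x = y := by simp [st]

@[simp] theorem st_ne_dl (x : St) (b : Bool) : st x ≠ dl b := by simp [st, dl]

theorem eq_dl_of_mem_dpow {k : ℤ} {x : (Unit ⊕ St) × Bool} (h : x ∈ dpow k) :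
    x = dl (decide (0 ≤ k)) := by
  unfold dpow at h
  split_ifs at h with hk <;> simp only [List.mem_replicate] at h <;> simp [h.2, hk]

@[simp] theorem st_notMem_dpow (x : St) (k : ℤ) : st x ∉ dpow k := fun h =>
  st_ne_dl _ _ (eq_dl_of_mem_dpow h)

@[simp] theorem dpow_zero : dpow 0 = [] := by simp [dpow]

@[simp] theorem dpow_one : dpow 1 = [dl true] := by simp [dpow]

theorem mk_replicate {α : Type} (x : α × Bool) (j : ℕ) :
    FreeGroup.mk (List.replicate j x) = FreeGroup.mk [x] ^ j := by
  induction j with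
  | zero => rfl
  | succ j ih => rw [List.replicate_succ, pow_succ', ← ih, FreeGroup.mul_mk]; rfl

theorem mk_dpow (k : ℤ) : FreeGroup.mk (dpow k) = FreeGroup.mk [dl true] ^ k := by
  unfold dpow
  split_ifs with hk
  · rw [mk_replicate, ← zpow_natCast, Int.toNat_of_nonneg hk]
  · have : FreeGroup.mk [dl false] = (FreeGroup.mk [dl true])⁻¹ := rfl
    rw [mk_replicate, this, ← zpow_natCast, Int.toNat_of_nonneg (by omega), inv_zpow', neg_neg]

theorem dpow_injective : Function.Injective dpow := by
  intro a b h
  unfold dpow at h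
  split_ifs at h with ha hb hb
  · have := congrArg List.length h
    simp at this; omega
  · rcases eq_or_ne b 0 with rfl | hb'
    · simp at hb
    · have hm : dl false ∈ List.replicate (-b).toNat (dl false) := by
        simp; omega
      rw [← h] at hm
      simp [dl] at hm
  · have hm : dl false ∈ List.replicate (-a).toNat (dl false) := by
      simp; omega
    rw [h] at hm
    simp [dl] at hm
  · have := congrArg List.length h
    simp at this; omega

theorem freeReduced_dpow (k : ℤ) : FreeReduced (dpow k) := by
  rw [freeReduced_iff_isChain]
  unfold dpow
  split_ifs <;> exact List.isChain_replicate_of_rel _ (by simp [dl])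

theorem freeReduced_cons_dpow (x y : St) (k : ℤ) {w : GWord Unit St}
    (hw : FreeReduced (st y :: w)) : FreeReduced (st x :: (dpow k ++ st y :: w)) := by
  rw [freeReduced_iff_isChain] at *
  rw [List.isChain_cons]
  refine ⟨?_, ?_⟩
  · intro z hz
    rcases List.mem_append.1 (List.mem_of_mem_head? hz) with h | h
    · rw [eq_dl_of_mem_dpow h]; simp [st, dl]
    · cases hd : dpow k with
      | nil => simp [hd] at hz; subst hz; simp [st]
      | cons c l =>
        simp only [hd, List.cons_append, List.head?_cons, Option.mem_def,
          Option.some.injEq] at hz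
        rw [eq_dl_of_mem_dpow (k := k) (x := z) (by simp [hd, hz])]; simp [st, dl]
  · rw [List.isChain_append]
    refine ⟨freeReduced_dpow k, hw, ?_⟩
    intro c hc z hz
    rw [eq_dl_of_mem_dpow (List.mem_of_mem_getLast? hc)]
    simp at hz
    subst hz
    simp [st, dl]

theorem wform_eq (p q r s t : St) (a b c d : ℤ) :
    wform p q r s t a b c d = st p :: (dpow a ++ st q :: (dpow b ++ st r ::
      (dpow c ++ st s :: (dpow d ++ [st t])))) := by
  simp [wform]

theorem freeReduced_wform (p q r s t : St) (a b c d : ℤ) :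
    FreeReduced (wform p q r s t a b c d) := by
  rw [wform_eq]
  iterate 4 apply freeReduced_cons_dpow
  simp [freeReduced_iff_isChain]

theorem st_mem_wform {x p q r s t : St} {a b c d : ℤ} :
    st x ∈ wform p q r s t a b c d ↔ x = p ∨ x = q ∨ x = r ∨ x = s ∨ x = t := by
  simp [wform_eq]

/-- The power `δ^k` as a word over the tape alphabet. -/
def tpow (k : ℤ) : List (Unit × Bool) := (dpow k).map fun x => ((), x.2)

theorem liftT_tpow (k : ℤ) : liftT (tpow k) = dpow k := by
  unfold liftT tpow
  rw [List.map_map]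
  conv_rhs => rw [← List.map_id (dpow k)]
  refine List.map_congr_left fun x hx => ?_
  rw [eq_dl_of_mem_dpow hx]; rfl

theorem freeReduced_tpow (k : ℤ) : FreeReduced (tpow k) := by
  rw [freeReduced_iff_isChain]
  unfold tpow dpow
  split_ifs <;> simp only [List.map_replicate] <;>
    exact List.isChain_replicate_of_rel _ (by simp [dl])

theorem admissible_wform {p q r s t : St} (hp : p = p1 ∨ p = p2 ∨ p = p3)
    (hq : q = q1 ∨ q = q2 ∨ q = q3) (hr : r = r1 ∨ r = r2 ∨ r = r3)
    (hs : s = s1 ∨ s = s2 ∨ s = s3) (ht : t = t1 ∨ t = t2 ∨ t = t3) (a b c d : ℤ) :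
    H1.Admissible (wform p q r s t a b c d) := by
  refine ⟨(![p, q, r, s, t] : Fin 5 → St), fun i => tpow ((![a, b, c, d] : Fin 4 → ℤ) i),
    ?_, fun i => ⟨fun _ _ => Set.mem_univ _, freeReduced_tpow _⟩, ?_⟩
  · show ∀ i : Fin 5, _
    intro i
    fin_cases i
    exacts [hp, hq, hr, hs, ht]
  · have : H1.assemble (![p, q, r, s, t] : Fin 5 → St)
        (fun i => tpow ((![a, b, c, d] : Fin 4 → ℤ) i)) =
        st p :: (liftT (tpow a)) ++ (st q :: liftT (tpow b) ++ (st r :: liftT (tpow c) ++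
          (st s :: liftT (tpow d) ++ []))) ++ [st t] := rfl
    rw [this]
    simp [wform, liftT_tpow]

/-! ### Splicing -/

theorem append_cons_eq_iff_of_notMem {α : Type} {x : α} {u v y w : List α} (hu : x ∉ u)
    (hv : x ∉ v) : u ++ x :: v = y ++ x :: w ↔ y = u ∧ w = v := by
  refine ⟨fun h => ?_, by rintro ⟨rfl, rfl⟩; rfl⟩
  induction u generalizing y with
  | nil =>
    cases y with
    | nil => simpa using h.symm
    | cons c y =>
      simp only [List.nil_append, List.cons_append, List.cons.injEq] at h
      simp [h.2] at hv
  | cons c u ih =>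
    cases y with
    | nil =>
      simp only [List.nil_append, List.cons_append, List.cons.injEq] at h
      simp [h.1] at hu
    | cons d y =>
      simp only [List.cons_append, List.cons.injEq] at h
      obtain ⟨h1, h2⟩ := ih (by simp_all) h.2
      simp [h.1, h1, h2]

theorem splice_cons_iff {T S : Type} {x : (T ⊕ S) × Bool} {u v U V : GWord T S}
    {rest : List (GWord T S × GWord T S)} {z : GWord T S} (hu : x ∉ u) (hv : x ∉ v) :
    Splice ((x :: U, V) :: rest) (u ++ x :: v) z ↔
      ∃ w₁ z₁, v = U ++ w₁ ∧ z = u ++ V ++ z₁ ∧ Splice rest w₁ z₁ := by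
  constructor
  · rintro ⟨y, w₁, z₁, h, rfl, hs⟩
    rw [List.append_assoc, List.cons_append, append_cons_eq_iff_of_notMem hu hv] at h
    obtain ⟨rfl, rfl⟩ := h
    exact ⟨w₁, z₁, rfl, rfl, hs⟩
  · rintro ⟨w₁, z₁, rfl, rfl, hs⟩
    exact ⟨u, w₁, z₁, by simp, rfl, hs⟩

theorem splice_singleton_cons_iff {T S : Type} {x : (T ⊕ S) × Bool} {u v V : GWord T S}
    {rest : List (GWord T S × GWord T S)} {z : GWord T S} (hu : x ∉ u) (hv : x ∉ v) :
    Splice (([x], V) :: rest) (u ++ x :: v) z ↔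
      ∃ z₁, z = u ++ V ++ z₁ ∧ Splice rest v z₁ := by
  rw [splice_cons_iff hu hv]
  simp

theorem subset_of_splice_cons {T S : Type} {U V w z : GWord T S}
    {rest : List (GWord T S × GWord T S)} (h : Splice ((U, V) :: rest) w z) : U ⊆ w := by
  obtain ⟨x, w₁, z₁, rfl, -, -⟩ := h
  intro c hc
  simp [hc]

theorem splice_two_iff {p q r s t : St} (h : [p, q, r, s, t].Nodup) {a b c d : ℤ}
    {A B z : GWord Unit St} :
    Splice [([st q], A), ([st r], B)] (wform p q r s t a b c d) z ↔
      z = st p :: (dpow a ++ A ++ dpow b ++ B ++ dpow c ++ st s :: (dpow d ++ [st t])) := by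
  simp only [List.nodup_cons, List.mem_cons, not_or, List.not_mem_nil] at h
  rw [wform_eq, ← List.cons_append, splice_singleton_cons_iff (by simp; grind) (by simp; grind)]
  simp only [splice_singleton_cons_iff (x := st r) (u := dpow b) (by simp)
    (show st r ∉ dpow c ++ st s :: (dpow d ++ [st t]) by simp; grind)]
  simp [Splice]

theorem splice_four_iff {p q r s t p' q' r' s' t' : St} (h : [p, q, r, s, t].Nodup)
    {a b c d e : ℤ} {z : GWord Unit St} :
    Splice [(st p :: (dpow e ++ [st q]), st p' :: (dpow e ++ [st q'])), ([st r], [st r']),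
      ([st s], [st s']), ([st t], [st t'])] (wform p q r s t a b c d) z ↔
      a = e ∧ z = wform p' q' r' s' t' a b c d := by
  simp only [List.nodup_cons, List.mem_cons, not_or, List.not_mem_nil] at h
  rw [wform_eq, ← List.nil_append (st p :: (dpow a ++ _)),
    splice_cons_iff (by simp) (by simp; grind)]
  have key : ∀ w₁, dpow a ++ st q :: (dpow b ++ st r :: (dpow c ++ st s :: (dpow d ++ [st t]))) =
      dpow e ++ [st q] ++ w₁ ↔ e = a ∧
        w₁ = dpow b ++ st r :: (dpow c ++ st s :: (dpow d ++ [st t])) := by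
    intro w₁
    rw [List.append_assoc, List.cons_append, List.nil_append,
      append_cons_eq_iff_of_notMem (by simp) (by simp; grind), dpow_injective.eq_iff]
  simp only [key]
  have hr : st r ∉ dpow c ++ st s :: (dpow d ++ [st t]) := by simp; grind
  have hs : st s ∉ dpow d ++ [st t] := by simp; grind
  constructor
  · rintro ⟨w₁, z₁, ⟨rfl, rfl⟩, rfl, hz⟩
    rw [splice_singleton_cons_iff (by simp) hr] at hz
    obtain ⟨z₂, rfl, hz⟩ := hz
    rw [splice_singleton_cons_iff (by simp) hs] at hz
    obtain ⟨z₃, rfl, hz⟩ := hz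
    rw [splice_singleton_cons_iff (by simp) (by simp)] at hz
    obtain ⟨z₄, rfl, hz⟩ := hz
    cases hz
    simp [wform]
  · rintro ⟨rfl, rfl⟩
    refine ⟨_, dpow b ++ [st r'] ++ (dpow c ++ [st s'] ++ (dpow d ++ [st t'] ++ [])),
      ⟨rfl, rfl⟩, by simp [wform], ?_⟩
    rw [splice_singleton_cons_iff (by simp) hr]
    refine ⟨_, rfl, ?_⟩
    rw [splice_singleton_cons_iff (by simp) hs]
    refine ⟨_, rfl, ?_⟩
    rw [splice_singleton_cons_iff (by simp) (by simp)]
    exact ⟨_, rfl, rfl⟩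

/-! ### The moves of `S₁` -/

theorem mk_st_cons (x : St) (l : GWord Unit St) :
    FreeGroup.mk (st x :: l) = FreeGroup.of (Sum.inr x) * FreeGroup.mk l := by
  rw [FreeGroup.of, FreeGroup.mul_mk]; rfl

theorem mk_append {α : Type} (l l' : List (α × Bool)) :
    FreeGroup.mk (l ++ l') = FreeGroup.mk l * FreeGroup.mk l' :=
  FreeGroup.mul_mk.symm

theorem applyRule_conj_iff {p q r s t : St} (h : [p, q, r, s, t].Nodup) {a b c d e f : ℤ}
    {w : GWord Unit St} :
    ApplyRule ⟨[([st q], dpow (-e) ++ st q :: dpow e), ([st r], dpow (-f) ++ st r :: dpow f)]⟩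
      (wform p q r s t a b c d) w ↔ w = wform p q r s t (a - e) (b + e - f) (c + f) d := by
  simp only [ApplyRule, splice_two_iff h, exists_eq_left]
  refine red_and_freeReduced_iff ?_ (freeReduced_wform ..)
  simp only [wform_eq, mk_append, mk_st_cons, mk_dpow, mul_assoc]
  group

theorem applyRule_relabel_iff {p q r s t p' q' r' s' t' : St} (h : [p, q, r, s, t].Nodup)
    {a b c d e : ℤ} {w : GWord Unit St} :
    ApplyRule ⟨[(st p :: (dpow e ++ [st q]), st p' :: (dpow e ++ [st q'])), ([st r], [st r']),
      ([st s], [st s']), ([st t], [st t'])]⟩ (wform p q r s t a b c d) w ↔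
      a = e ∧ w = wform p' q' r' s' t' a b c d := by
  simp only [ApplyRule, splice_four_iff h]
  constructor
  · rintro ⟨z, ⟨ha, rfl⟩, h⟩
    exact ⟨ha, (red_and_freeReduced_iff rfl (freeReduced_wform ..)).1 h⟩
  · rintro ⟨ha, rfl⟩
    exact ⟨_, ⟨ha, rfl⟩, (red_and_freeReduced_iff rfl (freeReduced_wform ..)).2 rfl⟩

/-- The word `pᵢ δ^(n - 2k) qᵢ δᵏ rᵢ δᵏ sᵢ δᵐ tᵢ`. -/
def config (n : ℕ) (m : ℤ) (i : Fin 3) (k : ℤ) : GWord Unit St :=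
  wform (pv i) (qv i) (rv i) (sv i) (tv i) (n - 2 * k) k k m

/-- `Move n r i k j l`: rule `r` takes `config n m i k` to `config n m j l`. -/
inductive Move (n : ℕ) : SRule Unit St → Fin 3 → ℤ → Fin 3 → ℤ → Prop
  | halve (k : ℤ) : Move n rule1 0 k 0 (k + 1)
  | unhalve (k : ℤ) : Move n (ruleInv rule1) 0 k 0 (k - 1)
  | even (k : ℤ) : (n : ℤ) = 2 * k → Move n rule2 0 k 1 k
  | uneven (k : ℤ) : (n : ℤ) = 2 * k → Move n (ruleInv rule2) 1 k 0 k
  | odd (k : ℤ) : (n : ℤ) = 2 * k + 1 → Move n rule3 0 k 2 k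
  | unodd (k : ℤ) : (n : ℤ) = 2 * k + 1 → Move n (ruleInv rule3) 2 k 0 k

theorem ruleInv_rule1 : ruleInv rule1 =
    ⟨[([st q1], dpow (-(-2)) ++ st q1 :: dpow (-2)),
      ([st r1], dpow (-(-1)) ++ st r1 :: dpow (-1))]⟩ := rfl

theorem ruleInv_rule2 : ruleInv rule2 =
    ⟨[(st p2 :: (dpow 0 ++ [st q2]), st p1 :: (dpow 0 ++ [st q1])), ([st r2], [st r1]),
      ([st s2], [st s1]), ([st t2], [st t1])]⟩ := rfl

theorem ruleInv_rule3 : ruleInv rule3 =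
    ⟨[(st p3 :: (dpow 1 ++ [st q3]), st p1 :: (dpow 1 ++ [st q1])), ([st r3], [st r1]),
      ([st s3], [st s1]), ([st t3], [st t1])]⟩ := rfl

theorem rule1_eq : rule1 =
    ⟨[([st q1], dpow (-2) ++ st q1 :: dpow 2), ([st r1], dpow (-1) ++ st r1 :: dpow 1)]⟩ := rfl

theorem rule2_eq : rule2 =
    ⟨[(st p1 :: (dpow 0 ++ [st q1]), st p2 :: (dpow 0 ++ [st q2])), ([st r1], [st r2]),
      ([st s1], [st s2]), ([st t1], [st t2])]⟩ := rfl

theorem rule3_eq : rule3 =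
    ⟨[(st p1 :: (dpow 1 ++ [st q1]), st p3 :: (dpow 1 ++ [st q3])), ([st r1], [st r3]),
      ([st s1], [st s3]), ([st t1], [st t3])]⟩ := rfl

theorem Move.applyRule {n : ℕ} {r : SRule Unit St} {i j : Fin 3} {k l : ℤ}
    (h : Move n r i k j l) (m : ℤ) : ApplyRule r (config n m i k) (config n m j l) := by
  cases h with
  | halve =>
    rw [rule1_eq]
    refine (applyRule_conj_iff (by decide)).2 ?_
    unfold config
    congr 1 <;> ring
  | unhalve =>
    rw [ruleInv_rule1]
    refine (applyRule_conj_iff (by decide)).2 ?_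
    unfold config
    congr 1 <;> ring
  | even _ h => exact rule2_eq ▸ (applyRule_relabel_iff (by decide)).2 ⟨by omega, rfl⟩
  | uneven _ h => exact ruleInv_rule2 ▸ (applyRule_relabel_iff (by decide)).2 ⟨by omega, rfl⟩
  | odd _ h => exact rule3_eq ▸ (applyRule_relabel_iff (by decide)).2 ⟨by omega, rfl⟩
  | unodd _ h => exact ruleInv_rule3 ▸ (applyRule_relabel_iff (by decide)).2 ⟨by omega, rfl⟩

theorem st_mem_config {n : ℕ} {m : ℤ} {i : Fin 3} {k : ℤ} {x : St} :
    st x ∈ config n m i k ↔ x = pv i ∨ x = qv i ∨ x = rv i ∨ x = sv i ∨ x = tv i :=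
  st_mem_wform

theorem p_mem_config {n : ℕ} {m : ℤ} {i : Fin 3} {k : ℤ} (j : Fin 3) :
    st (pv j) ∈ config n m i k ↔ i = j := by
  rw [st_mem_config]; revert i j; decide

theorem q_mem_config {n : ℕ} {m : ℤ} {i : Fin 3} {k : ℤ} (j : Fin 3) :
    st (qv j) ∈ config n m i k ↔ i = j := by
  rw [st_mem_config]; revert i j; decide

theorem exists_move_of_applyRule {n : ℕ} {m : ℤ} {r : SRule Unit St} (hr : r ∈ M1.rules)
    {i : Fin 3} {k : ℤ} {w : GWord Unit St} (h : ApplyRule r (config n m i k) w) :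
    ∃ j l, Move n r i k j l ∧ w = config n m j l := by
  have hi : ∀ {U V rest} (j : Fin 3), r = ⟨(U, V) :: rest⟩ → st (qv j) ∈ U → i = j := by
    rintro U V rest j rfl hU
    obtain ⟨z, hz, -⟩ := h
    exact (q_mem_config j).1 (subset_of_splice_cons hz hU)
  simp only [M1, List.mem_cons, List.not_mem_nil, or_false] at hr
  rcases hr with rfl | rfl | rfl | rfl | rfl | rfl
  · obtain rfl := hi 0 rule1_eq (by simp [qv])
    refine ⟨_, _, .halve k, ?_⟩
    rw [rule1_eq] at h
    rw [(applyRule_conj_iff (by decide)).1 h]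
    unfold config
    congr 1 <;> ring
  · obtain rfl := hi 0 rule2_eq (by simp [qv])
    rw [rule2_eq] at h
    obtain ⟨ha, rfl⟩ := (applyRule_relabel_iff (by decide)).1 h
    exact ⟨_, _, .even k (by omega), rfl⟩
  · obtain rfl := hi 0 rule3_eq (by simp [qv])
    rw [rule3_eq] at h
    obtain ⟨ha, rfl⟩ := (applyRule_relabel_iff (by decide)).1 h
    exact ⟨_, _, .odd k (by omega), rfl⟩
  · obtain rfl := hi 0 ruleInv_rule1 (by simp [qv])
    refine ⟨_, _, .unhalve k, ?_⟩
    rw [ruleInv_rule1] at h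
    rw [(applyRule_conj_iff (by decide)).1 h]
    unfold config
    congr 1 <;> ring
  · obtain rfl := hi 1 ruleInv_rule2 (by simp [qv])
    rw [ruleInv_rule2] at h
    obtain ⟨ha, rfl⟩ := (applyRule_relabel_iff (by decide)).1 h
    exact ⟨_, _, .uneven k (by omega), rfl⟩
  · obtain rfl := hi 2 ruleInv_rule3 (by simp [qv])
    rw [ruleInv_rule3] at h
    obtain ⟨ha, rfl⟩ := (applyRule_relabel_iff (by decide)).1 h
    exact ⟨_, _, .unodd k (by omega), rfl⟩

theorem Move.mem_rules {n : ℕ} {r : SRule Unit St} {i j : Fin 3} {k l : ℤ}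
    (h : Move n r i k j l) : r ∈ M1.rules := by
  cases h <;> decide

theorem Move.unique {n : ℕ} {r : SRule Unit St} {i j j' : Fin 3} {k l l' : ℤ}
    (h : Move n r i k j l) (h' : Move n r i k j' l') : j = j' ∧ l = l' := by
  generalize hr : r = ρ at h'
  cases h <;> cases h' <;> first | exact ⟨rfl, rfl⟩ | exact absurd hr (by decide)

theorem admissible_config (n : ℕ) (m : ℤ) (i : Fin 3) (k : ℤ) :
    M1.H.Admissible (config n m i k) := by
  refine admissible_wform ?_ ?_ ?_ ?_ ?_ _ _ _ _ <;> revert i <;> decide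

/-! ### Computations -/

theorem isComputation_nil_iff {T S : Type} {M : SMachine T S} {w : GWord T S}
    {ws : List (GWord T S)} :
    IsComputation M (w :: ws) [] ↔ ws = [] ∧ M.H.Admissible w := by
  constructor
  · rintro ⟨-, hl, ha, -⟩
    exact ⟨by simpa [eq_comm] using hl, ha w (by simp)⟩
  · rintro ⟨rfl, ha⟩
    exact ⟨by simp, by simp, by simpa using ha, by simp⟩

theorem isComputation_cons_iff {T S : Type} {M : SMachine T S} {w : GWord T S}
    {ws : List (GWord T S)} {r : SRule T S} {h : List (SRule T S)} :
    IsComputation M (w :: ws) (r :: h) ↔ ∃ w' ws', ws = w' :: ws' ∧ M.H.Admissible w ∧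
      r ∈ M.rules ∧ ApplyRule r w w' ∧ IsComputation M (w' :: ws') h := by
  constructor
  · rintro ⟨-, hl, ha, hs⟩
    cases ws with
    | nil => simp at hl
    | cons w' ws' =>
      obtain ⟨h1, h2⟩ := hs 0 (by simp)
      refine ⟨w', ws', rfl, ha w (by simp), h1, h2, by simp, by simpa using hl,
        fun v hv => ha v (by simp_all), fun i hi => ?_⟩
      simpa using hs (i + 1) (by simpa using hi)
  · rintro ⟨w', ws', rfl, ha, hr, happ, -, hl, ha', hs⟩
    refine ⟨by simp, by simpa using hl, by simpa using ⟨ha, by simpa using ha'⟩, ?_⟩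
    rintro (_ | i) hi
    · exact ⟨hr, happ⟩
    · simpa using hs i (by simpa using hi)

theorem reducedHist_iff_isChain {T S : Type} (h : List (SRule T S)) :
    ReducedHist h ↔ h.IsChain fun a b => b ≠ ruleInv a := by
  rw [List.isChain_iff_getElem]
  refine forall_congr' fun i => forall_congr' fun hi => ?_
  rw [List.getD_eq_getElem _ _ hi, List.getD_eq_getElem _ _ (by omega)]

theorem isComputation_config_cons_iff {n : ℕ} {m : ℤ} {i : Fin 3} {k : ℤ}
    {ws : List (GWord Unit St)} {r : SRule Unit St} {h : List (SRule Unit St)} :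
    IsComputation M1 (config n m i k :: ws) (r :: h) ↔ ∃ j l ws', Move n r i k j l ∧
      ws = config n m j l :: ws' ∧ IsComputation M1 (config n m j l :: ws') h := by
  rw [isComputation_cons_iff]
  constructor
  · rintro ⟨w', ws', rfl, -, hr, happ, hc⟩
    obtain ⟨j, l, hm, rfl⟩ := exists_move_of_applyRule hr happ
    exact ⟨j, l, ws', hm, rfl, hc⟩
  · rintro ⟨j, l, ws', hm, rfl, hc⟩
    exact ⟨_, ws', rfl, admissible_config .., hm.mem_rules, hm.applyRule m, hc⟩

theorem IsComputation.tail_unique {n : ℕ} {m : ℤ} {i : Fin 3} {k : ℤ}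
    {ws ws' : List (GWord Unit St)} {h : List (SRule Unit St)}
    (hc : IsComputation M1 (config n m i k :: ws) h)
    (hc' : IsComputation M1 (config n m i k :: ws') h) : ws = ws' := by
  induction h generalizing i k ws ws' with
  | nil => rw [(isComputation_nil_iff.1 hc).1, (isComputation_nil_iff.1 hc').1]
  | cons r h ih =>
    obtain ⟨j, l, vs, hm, rfl, hv⟩ := isComputation_config_cons_iff.1 hc
    obtain ⟨j', l', vs', hm', rfl, htl⟩ := isComputation_config_cons_iff.1 hc'
    obtain ⟨rfl, rfl⟩ := hm.unique hm'
    exact ih hv htl ▸ rfl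

/-- The parity constraint on `n` and `k` in state `i`. -/
def ParityOK (n : ℕ) (i : Fin 3) (k : ℤ) : Prop :=
  (i = 1 → (n : ℤ) = 2 * k) ∧ (i = 2 → (n : ℤ) = 2 * k + 1)

theorem parityOK_zero (n : ℕ) (k : ℤ) : ParityOK n 0 k := by simp [ParityOK]

theorem Move.parityOK {n : ℕ} {r : SRule Unit St} {i j : Fin 3} {k l : ℤ}
    (h : Move n r i k j l) : ParityOK n j l := by
  cases h <;> simp_all [ParityOK]

theorem IsComputation.forall_mem_eq_config {n : ℕ} {m : ℤ} {i : Fin 3} {k : ℤ}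
    {ws : List (GWord Unit St)} {h : List (SRule Unit St)}
    (hc : IsComputation M1 (config n m i k :: ws) h) (hb : ParityOK n i k) :
    ∀ v ∈ config n m i k :: ws, ∃ j l, v = config n m j l ∧ ParityOK n j l := by
  induction h generalizing i k ws with
  | nil =>
    obtain ⟨rfl, -⟩ := isComputation_nil_iff.1 hc
    simpa using ⟨i, k, rfl, hb⟩
  | cons r h ih =>
    obtain ⟨j, l, vs, hm, rfl, hv⟩ := isComputation_config_cons_iff.1 hc
    rw [List.forall_mem_cons]
    exact ⟨⟨i, k, rfl, hb⟩, ih hv hm.parityOK⟩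

/-! ### Reduced computations of `S₁` -/

/-- Rule (1) or its inverse. -/
def dir (b : Bool) : SRule Unit St := if b then rule1 else ruleInv rule1

/-- The change of exponent caused by `dir b`. -/
def sgn (b : Bool) : ℤ := if b then 1 else -1

/-- The rules leading from state `0` to state `i`. -/
def finish : Fin 3 → List (SRule Unit St) := ![[], [rule2], [rule3]]

theorem move_dir_iff {n : ℕ} {b : Bool} {k l : ℤ} {j : Fin 3} :
    Move n (dir b) 0 k j l ↔ j = 0 ∧ l = k + sgn b := by
  constructor
  · intro h
    cases b
    · exact h.unique (.unhalve k)
    · exact h.unique (.halve k)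
  · rintro ⟨rfl, rfl⟩
    cases b
    exacts [.unhalve k, .halve k]

theorem ruleInv_dir (b : Bool) : ruleInv (dir b) = dir (!b) := by
  cases b <;> decide

theorem isComputation_dir_cons_iff {n : ℕ} {m : ℤ} {k : ℤ} {b : Bool}
    {ws : List (GWord Unit St)} {h : List (SRule Unit St)} :
    IsComputation M1 (config n m 0 k :: ws) (dir b :: h) ↔
      ∃ ws', ws = config n m 0 (k + sgn b) :: ws' ∧
        IsComputation M1 (config n m 0 (k + sgn b) :: ws') h := by
  rw [isComputation_config_cons_iff]
  constructor
  · rintro ⟨j, l, ws', hm, rfl, hc⟩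
    obtain ⟨rfl, rfl⟩ := move_dir_iff.1 hm
    exact ⟨ws', rfl, hc⟩
  · rintro ⟨ws', rfl, hc⟩
    exact ⟨_, _, ws', move_dir_iff.2 ⟨rfl, rfl⟩, rfl, hc⟩

theorem Move.eq_of_mem_finish {n : ℕ} {r : SRule Unit St} {i j : Fin 3} {k l : ℤ}
    (h : Move n r 0 k j l) (hr : r ∈ finish i) : j = i ∧ l = k := by
  cases h <;> fin_cases i <;> first | exact ⟨rfl, rfl⟩ | exact absurd hr (by decide)

theorem isComputation_finish_iff {n : ℕ} {m : ℤ} {i : Fin 3} {k : ℤ}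
    {ws : List (GWord Unit St)} :
    IsComputation M1 (config n m 0 k :: ws) (finish i) ↔
      ws = (if i = 0 then [] else [config n m i k]) ∧ ParityOK n i k := by
  have key : ∀ r, i ≠ 0 → finish i = [r] → (ParityOK n i k → Move n r 0 k i k) →
      (IsComputation M1 (config n m 0 k :: ws) (finish i) ↔
        ws = (if i = 0 then [] else [config n m i k]) ∧ ParityOK n i k) := by
    intro r hi hr hm
    rw [hr, isComputation_config_cons_iff, if_neg hi]
    constructor
    · rintro ⟨j, l, ws', hm', rfl, hc⟩
      obtain ⟨rfl, rfl⟩ := hm'.eq_of_mem_finish (i := i) (by simp [hr])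
      rw [(isComputation_nil_iff.1 hc).1]
      exact ⟨rfl, hm'.parityOK⟩
    · rintro ⟨rfl, hp⟩
      exact ⟨i, k, [], hm hp, rfl, isComputation_nil_iff.2 ⟨rfl, admissible_config ..⟩⟩
  match i with
  | 0 => simp [finish, isComputation_nil_iff, admissible_config, parityOK_zero]
  | 1 => exact key rule2 (by decide) rfl fun hp => .even k (hp.1 rfl)
  | 2 => exact key rule3 (by decide) rfl fun hp => .odd k (hp.2 rfl)

theorem exists_history_eq {n : ℕ} {m k : ℤ} {ws : List (GWord Unit St)}
    {h : List (SRule Unit St)} (hc : IsComputation M1 (config n m 0 k :: ws) h)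
    (hr : h.IsChain fun a b => b ≠ ruleInv a) :
    ∃ b j i, h = List.replicate j (dir b) ++ finish i := by
  induction h generalizing k ws with
  | nil => exact ⟨true, 0, 0, rfl⟩
  | cons r h ih =>
    rw [List.isChain_cons] at hr
    obtain ⟨j, l, vs, hm, rfl, hv⟩ := isComputation_config_cons_iff.1 hc
    have hdir : ∀ b, r = dir b → j = 0 →
        ∃ b j i, r :: h = List.replicate j (dir b) ++ finish i := by
      rintro b rfl rfl
      obtain ⟨b', j, i, rfl⟩ := ih hv hr.2
      cases j with
      | zero => exact ⟨b, 1, i, rfl⟩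
      | succ j =>
        have hb : dir b' ≠ ruleInv (dir b) := hr.1 _ (by simp [List.replicate_succ])
        have : b' = b := by
          rw [ruleInv_dir] at hb
          cases b <;> cases b' <;> simp_all
        subst this
        exact ⟨b', j + 2, i, rfl⟩
    have hend : ∀ i, [r] = finish i → (∀ r' j' l', Move n r' j l j' l' → r' = ruleInv r) →
        ∃ b j i, r :: h = List.replicate j (dir b) ++ finish i := by
      intro i hi huniq
      refine ⟨true, 0, i, ?_⟩
      cases h with
      | nil => exact hi
      | cons r' h' =>
        obtain ⟨j', l', -, hm', -, -⟩ := isComputation_config_cons_iff.1 hv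
        exact absurd (huniq _ _ _ hm') (hr.1 r' (by simp))
    cases hm with
    | halve => exact hdir true rfl rfl
    | unhalve => exact hdir false rfl rfl
    | even => exact hend 1 rfl fun r' j' l' hm' => by cases hm'; rfl
    | odd => exact hend 2 rfl fun r' j' l' hm' => by cases hm'; rfl

theorem lastW_eq_config {n : ℕ} {m k : ℤ} {b : Bool} {j : ℕ} {i : Fin 3}
    {ws : List (GWord Unit St)}
    (hc : IsComputation M1 (config n m 0 k :: ws) (List.replicate j (dir b) ++ finish i)) :
    lastW (config n m 0 k :: ws) = config n m i (k + sgn b * j) ∧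
      ParityOK n i (k + sgn b * j) := by
  induction j generalizing k ws with
  | zero =>
    obtain ⟨rfl, hb⟩ := isComputation_finish_iff.1 hc
    refine ⟨?_, by simpa using hb⟩
    split_ifs with hi <;> simp [lastW, hi]
  | succ j ih =>
    rw [List.replicate_succ, List.cons_append] at hc
    obtain ⟨ws', rfl, hc'⟩ := isComputation_dir_cons_iff.1 hc
    have hk : k + sgn b * (j + 1 : ℕ) = k + sgn b + sgn b * j := by push_cast; ring
    rw [hk]
    exact ih hc'

theorem exists_isComputation {n : ℕ} {m k : ℤ} {b : Bool} {j : ℕ} {i : Fin 3}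
    (hb : ParityOK n i (k + sgn b * j)) :
    ∃ ws, IsComputation M1 (config n m 0 k :: ws) (List.replicate j (dir b) ++ finish i) := by
  induction j generalizing k with
  | zero => exact ⟨_, isComputation_finish_iff.2 ⟨rfl, by simpa using hb⟩⟩
  | succ j ih =>
    have hk : k + sgn b * (j + 1 : ℕ) = k + sgn b + sgn b * j := by push_cast; ring
    obtain ⟨ws, hws⟩ := ih (hk ▸ hb)
    exact ⟨_, isComputation_dir_cons_iff.2 ⟨ws, rfl, hws⟩⟩

theorem reducedHist_replicate_append_finish (b : Bool) (j : ℕ) (i : Fin 3) :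
    ReducedHist (List.replicate j (dir b) ++ finish i) := by
  rw [reducedHist_iff_isChain, List.isChain_append]
  refine ⟨List.isChain_replicate_of_rel _ (by cases b <;> decide), ?_, ?_⟩
  · fin_cases i <;> simp [finish]
  · intro x hx y hy
    obtain rfl : x = dir b := (List.mem_replicate.1 (List.mem_of_mem_getLast? hx)).2
    fin_cases i <;> simp [finish] at hy <;> subst hy <;> cases b <;> decide

/-! ### Negative letters -/

theorem negCount_append {T S : Type} [DecidableEq T] (a : T) (u v : GWord T S) :
    negCount a (u ++ v) = negCount a u + negCount a v :=
  List.countP_append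

theorem negCount_st_cons (x : St) (u : GWord Unit St) :
    negCount () (st x :: u) = negCount () u := by
  simp [negCount, st]

theorem negCount_dpow (k : ℤ) : negCount () (dpow k : GWord Unit St) = (-k).toNat := by
  unfold dpow negCount
  split_ifs with h
  · simp [List.countP_replicate, dl]; omega
  · simp [List.countP_replicate, dl]

theorem negCount_config (n : ℕ) (m : ℤ) (i : Fin 3) (k : ℤ) :
    negCount () (config n m i k) =
      (2 * k - n).toNat + (-k).toNat + (-k).toNat + (-m).toNat := by
  have : negCount () ([] : GWord Unit St) = 0 := rfl
  simp only [config, wform_eq, negCount_st_cons, negCount_append, negCount_dpow, this]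
  rw [neg_sub]
  ring

theorem semiproper_of_isChain {ws : List (GWord Unit St)}
    (h : ws.IsChain fun v w => negCount () v ≤ negCount () w) : Semiproper ws := by
  have : IsTrans (GWord Unit St) fun v w => negCount () v ≤ negCount () w :=
    ⟨fun _ _ _ h h' => le_trans h h'⟩
  rintro ⟨⟩ i j hij hj
  rw [List.getD_eq_getElem _ _ hj, List.getD_eq_getElem _ _ (hij.trans_lt hj)]
  refine (Nat.sub_le _ _).trans ?_
  rcases hij.eq_or_lt with rfl | hij
  · exact le_rfl
  · exact List.pairwise_iff_getElem.1 h.pairwise _ _ _ hj hij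

theorem isChain_negCount {n : ℕ} {m k : ℤ} {b : Bool} {j : ℕ} {i : Fin 3}
    {ws : List (GWord Unit St)} (hk : 0 ≤ sgn b * k)
    (hc : IsComputation M1 (config n m 0 k :: ws) (List.replicate j (dir b) ++ finish i)) :
    (config n m 0 k :: ws).IsChain fun v w => negCount () v ≤ negCount () w := by
  induction j generalizing k ws with
  | zero =>
    obtain ⟨rfl, -⟩ := isComputation_finish_iff.1 hc
    split_ifs <;> simp [negCount_config]
  | succ j ih =>
    rw [List.replicate_succ, List.cons_append] at hc
    obtain ⟨ws', rfl, hc'⟩ := isComputation_dir_cons_iff.1 hc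
    rw [List.isChain_cons_cons]
    refine ⟨?_, ih ?_ hc'⟩
    · rw [negCount_config, negCount_config]
      cases b <;> simp [sgn] at hk ⊢ <;> omega
    · cases b <;> simp [sgn] at hk ⊢ <;> omega

/-! ### Computations starting at `W` -/

theorem Wst_eq_config (n : ℕ) (m : ℤ) : Wst n m = config n m 0 0 := by
  simp [Wst, config, pv, qv, rv, sv, tv]

theorem exists_eq_cons {n : ℕ} {m : ℤ} {ws : List (GWord Unit St)} {h : List (SRule Unit St)}
    (hc : IsComputation M1 ws h) (hf : firstW ws = Wst n m) :
    ∃ ws', ws = config n m 0 0 :: ws' := by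
  cases ws with
  | nil => exact absurd rfl hc.1
  | cons w ws => exact ⟨ws, by rw [← Wst_eq_config, ← hf]; rfl⟩

theorem eq_zero_of_infix_config {n : ℕ} {m : ℤ} {i : Fin 3} {k : ℤ}
    (h : [st q1, st r1] <:+: config n m i k) : k = 0 := by
  obtain rfl : i = 0 := (q_mem_config 0).1 (h.subset (by simp [qv]))
  obtain ⟨x, y, h⟩ := h
  rw [config, wform_eq, ← List.cons_append, List.append_assoc] at h
  obtain ⟨-, h⟩ := (append_cons_eq_iff_of_notMem (by simp [pv, qv])
    (by simp [qv, rv, sv, tv])).1 h.symm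
  obtain ⟨h, -⟩ := (append_cons_eq_iff_of_notMem (y := []) (by simp)
    (by simp [rv, sv, tv])).1 h.symm
  exact dpow_injective (by simpa using h.symm)

theorem InCS.eq_replicate {n : ℕ} {m : ℤ} {ws : List (GWord Unit St)}
    {h : List (SRule Unit St)} {i : Fin 3} (hi : i ≠ 0)
    (hc : InCS M1 ws h (Wst n m) [[st (pv i)]]) :
    ∃ j : ℕ, h = List.replicate j rule1 ++ finish i ∧ lastW ws = config n m i j ∧
      ParityOK n i j := by
  obtain ⟨hc, hr, hf, hv⟩ := hc
  obtain ⟨ws, rfl⟩ := exists_eq_cons hc hf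
  obtain ⟨b, j, i', rfl⟩ := exists_history_eq hc ((reducedHist_iff_isChain h).1 hr)
  obtain ⟨hl, hb⟩ := lastW_eq_config hc
  have hmem := (hv _ (List.mem_singleton_self _)).subset (List.mem_singleton_self _)
  rw [hl, p_mem_config] at hmem
  subst hmem
  cases b with
  | true => exact ⟨j, rfl, by simpa [sgn] using hl, by simpa [sgn] using hb⟩
  | false =>
    obtain rfl : j = 0 := by
      simp only [ParityOK, sgn] at hb
      fin_cases i' <;> simp at hi hb <;> omega
    exact ⟨0, rfl, by simpa using hl, by simpa using hb⟩

theorem InCS.unique {n : ℕ} {m : ℤ} {ws ws' : List (GWord Unit St)}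
    {h : List (SRule Unit St)} {vs : List (GWord Unit St)}
    (hc : InCS M1 ws h (Wst n m) vs) (hc' : InCS M1 ws' h (Wst n m) vs) : ws = ws' := by
  obtain ⟨ws, rfl⟩ := exists_eq_cons hc.1 hc.2.2.1
  obtain ⟨ws', rfl⟩ := exists_eq_cons hc'.1 hc'.2.2.1
  rw [hc.1.tail_unique hc'.1]

theorem exists_inCS {n : ℕ} (m : ℤ) {j : ℕ} {i : Fin 3} (hb : ParityOK n i j) :
    ∃ ws, InCS M1 ws (List.replicate j rule1 ++ finish i) (Wst n m) [[st (pv i)]] := by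
  obtain ⟨ws, hc⟩ := exists_isComputation (n := n) (m := m) (k := 0) (b := true) (j := j)
    (i := i) (by simpa [sgn] using hb)
  refine ⟨_, hc, reducedHist_replicate_append_finish true j i, (Wst_eq_config n m).symm, ?_⟩
  rw [List.forall_mem_singleton, (lastW_eq_config hc).1, List.singleton_infix_iff, p_mem_config]

theorem parityOK_of_infix_lastW {n : ℕ} {m : ℤ} {i : Fin 3} {ws : List (GWord Unit St)}
    {h : List (SRule Unit St)} (hc : IsComputation M1 ws h) (hf : firstW ws = Wst n m)
    (hv : [st (pv i)] <:+: lastW ws) : ∃ k, ParityOK n i k := by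
  obtain ⟨ws, rfl⟩ := exists_eq_cons hc hf
  obtain ⟨j, l, hw, hp⟩ := hc.forall_mem_eq_config (parityOK_zero n 0) _
    (List.getLast_mem (List.cons_ne_nil _ _))
  rw [lastW, List.getLastD_eq_getLast?, List.getLast?_eq_some_getLast (List.cons_ne_nil _ _),
    Option.getD_some, hw, List.singleton_infix_iff, p_mem_config] at hv
  exact ⟨l, hv ▸ hp⟩

/-- machine `S₁` divides a number by `2` and tells even from odd. -/
theorem machine_S1 (n : ℕ) (m : ℤ) :
    -- (i) every reduced computation starting at `W` is semiproper
    (∀ ws h, IsComputation M1 ws h → ReducedHist h → firstW ws = Wst n m →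
      Semiproper ws) ∧
    -- (ii) every word in any computation starting at `W` has the prescribed form
    (∀ ws h, IsComputation M1 ws h → firstW ws = Wst n m → ∀ v ∈ ws,
      ∃ (i : Fin 3) (l1 l2 : ℤ), l1 + 2 * l2 = (n : ℤ) ∧
        v = wform (pv i) (qv i) (rv i) (sv i) (tv i) l1 l2 l2 m) ∧
    -- (iii) `CS₁(W, q₁r₁)` consists of the single trivial computation
    (∀ ws h, InCS M1 ws h (Wst n m) [[st q1, st r1]] → ws = [Wst n m] ∧ h = []) ∧
    -- (iv) `S₁(W, p₂)` holds iff `n` is even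
    ((∃ ws h, IsComputation M1 ws h ∧ firstW ws = Wst n m ∧ [st p2] <:+: lastW ws) ↔
      Even n) ∧
    (Even n →
      (∃ ws h, InCS M1 ws h (Wst n m) [[st p2]]) ∧
      (∀ ws h, InCS M1 ws h (Wst n m) [[st p2]] →
        h = List.replicate (n / 2) rule1 ++ [rule2] ∧ lastW ws = W2 n m) ∧
      (∀ ws h ws' h', InCS M1 ws h (Wst n m) [[st p2]] →
        InCS M1 ws' h' (Wst n m) [[st p2]] → ws = ws' ∧ h = h')) ∧
    -- (v) `S₁(W, p₃)` holds iff `n` is odd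
    ((∃ ws h, IsComputation M1 ws h ∧ firstW ws = Wst n m ∧ [st p3] <:+: lastW ws) ↔
      Odd n) ∧
    (Odd n →
      (∃ ws h, InCS M1 ws h (Wst n m) [[st p3]]) ∧
      (∀ ws h, InCS M1 ws h (Wst n m) [[st p3]] →
        h = List.replicate ((n - 1) / 2) rule1 ++ [rule3] ∧ lastW ws = W3 n m) ∧
      (∀ ws h ws' h', InCS M1 ws h (Wst n m) [[st p3]] →
        InCS M1 ws' h' (Wst n m) [[st p3]] → ws = ws' ∧ h = h')) := by
  refine ⟨?_, ?_, ?_, ?_, ?_, ?_, ?_⟩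
  · intro ws h hc hr hf
    obtain ⟨ws, rfl⟩ := exists_eq_cons hc hf
    obtain ⟨b, j, i, rfl⟩ := exists_history_eq hc ((reducedHist_iff_isChain h).1 hr)
    exact semiproper_of_isChain (isChain_negCount (by simp) hc)
  · intro ws h hc hf v hv
    obtain ⟨ws, rfl⟩ := exists_eq_cons hc hf
    obtain ⟨i, k, rfl, -⟩ := hc.forall_mem_eq_config (parityOK_zero n 0) v hv
    exact ⟨i, n - 2 * k, k, by ring, rfl⟩
  · rintro ws h ⟨hc, hr, hf, hv⟩
    obtain ⟨ws, rfl⟩ := exists_eq_cons hc hf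
    obtain ⟨b, j, i, rfl⟩ := exists_history_eq hc ((reducedHist_iff_isChain h).1 hr)
    have hinf := hv _ (List.mem_singleton_self _)
    rw [(lastW_eq_config hc).1] at hinf
    have hj := eq_zero_of_infix_config hinf
    obtain rfl : i = 0 := ((q_mem_config 0).1 (hinf.subset (by simp [qv])))
    obtain rfl : j = 0 := by cases b <;> simpa [sgn] using hj
    obtain ⟨rfl, -⟩ := isComputation_nil_iff.1 hc
    exact ⟨by rw [Wst_eq_config], rfl⟩
  · constructor
    · rintro ⟨ws, h, hc, hf, hv⟩
      obtain ⟨k, hk, -⟩ := parityOK_of_infix_lastW (i := 1) hc hf hv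
      have := hk rfl
      exact Nat.even_iff.2 (by omega)
    · intro hn
      obtain ⟨j, rfl⟩ := hn.two_dvd
      obtain ⟨ws, hc, -, hf, hv⟩ :=
        exists_inCS (n := 2 * j) m (j := j) (i := 1) (by simp [ParityOK])
      exact ⟨ws, _, hc, hf, hv _ (by simp [pv])⟩
  · intro hn
    obtain ⟨j, rfl⟩ := hn.two_dvd
    have key : ∀ ws h, InCS M1 ws h (Wst (2 * j) m) [[st p2]] →
        h = List.replicate (2 * j / 2) rule1 ++ [rule2] ∧ lastW ws = W2 (2 * j) m := by
      intro ws h hc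
      obtain ⟨j', rfl, hl, hp, -⟩ := hc.eq_replicate (i := 1) (by decide)
      obtain rfl : j' = j := by have := hp rfl; omega
      refine ⟨by simp [finish], ?_⟩
      simp [hl, config, W2, pv, qv, rv, sv, tv]
    refine ⟨?_, key, ?_⟩
    · obtain ⟨ws, hc⟩ := exists_inCS (n := 2 * j) m (j := j) (i := 1) (by simp [ParityOK])
      exact ⟨ws, _, hc⟩
    · intro ws h ws' h' hc hc'
      obtain rfl : h = h' := (key _ _ hc).1.trans (key _ _ hc').1.symm
      exact ⟨hc.unique hc', rfl⟩
  · constructor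
    · rintro ⟨ws, h, hc, hf, hv⟩
      obtain ⟨k, -, hk⟩ := parityOK_of_infix_lastW (i := 2) hc hf hv
      have := hk rfl
      exact Nat.odd_iff.2 (by omega)
    · rintro ⟨j, rfl⟩
      obtain ⟨ws, hc, -, hf, hv⟩ :=
        exists_inCS (n := 2 * j + 1) m (j := j) (i := 2) (by simp [ParityOK])
      exact ⟨ws, _, hc, hf, hv _ (by simp [pv])⟩
  · rintro ⟨j, rfl⟩
    have key : ∀ ws h, InCS M1 ws h (Wst (2 * j + 1) m) [[st p3]] →
        h = List.replicate ((2 * j + 1 - 1) / 2) rule1 ++ [rule3] ∧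
          lastW ws = W3 (2 * j + 1) m := by
      intro ws h hc
      obtain ⟨j', rfl, hl, -, hp⟩ := hc.eq_replicate (i := 2) (by decide)
      obtain rfl : j' = j := by have := hp rfl; omega
      refine ⟨by simp [finish], ?_⟩
      simp [hl, config, W3, pv, qv, rv, sv, tv]
    refine ⟨?_, key, ?_⟩
    · obtain ⟨ws, hc⟩ := exists_inCS (n := 2 * j + 1) m (j := j) (i := 2) (by simp [ParityOK])
      exact ⟨ws, _, hc⟩
    · intro ws h ws' h' hc hc'
      obtain rfl : h = h' := (key _ _ hc).1.trans (key _ _ hc').1.symm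
      exact ⟨hc.unique hc', rfl⟩
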